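/- arXiv:2402.07424 — 3 statements merged into one kernel-verified Lean document; each statement's English description precedes it below -/
import Mathlib

section
/- Fix integers k ≥ 1 and n ≥ 1. The number of set-valued tableaux of single-row shape (k) with entries in {1,…,n} is |SVT((k), n)| = C(n+k−1, k) · Σ_{m=0}^{n−1} (k/(k+m)) · C(n−1, m). (The sum equals the terminating Gauss hypergeometric value ₂F₁(k, 1−n; k+1; −1).) -/
open Finset

/-- The set of boxes of the Young diagram of `lam` within the first `n` rows
(rows indexed `0, …, n-1`; box `(i,j)` is present iff `j < lam i`). -/
def youngCells (n : ℕ) (lam : ℕ → ℕ) : Finset (ℕ × ℕ) :=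
  (Finset.range n).biUnion fun i => {i} ×ˢ Finset.range (lam i)

/-- Set-valued tableaux of shape `lam` with entries in `{1, …, n}`, encoded as finite
sets of pairs (box, entry): the nonempty set assigned to a box `p` is `{e | (p, e) ∈ T}`.
The conditions say: every box of the diagram gets at least one entry; all entries lie in
`{1, …, n}`; entries weakly increase along rows (`max T_{i,j} ≤ min T_{i,j+1}`) and
strictly increase down columns (`max T_{i,j} < min T_{i+1,j}`).
For a tableau `T`, the total number of assigned entries `|T|` is `T.card`. -/
def SVT (n : ℕ) (lam : ℕ → ℕ) : Finset (Finset ((ℕ × ℕ) × ℕ)) :=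
  ((youngCells n lam) ×ˢ Finset.Icc 1 n).powerset.filter fun T =>
    (∀ p ∈ youngCells n lam, ∃ x ∈ T, x.1 = p) ∧
    (∀ x ∈ T, ∀ y ∈ T, x.1.1 = y.1.1 → x.1.2 + 1 = y.1.2 → x.2 ≤ y.2) ∧
    (∀ x ∈ T, ∀ y ∈ T, x.1.1 + 1 = y.1.1 → x.1.2 = y.1.2 → x.2 < y.2)

/-- A single-row tableau with `k` boxes and entries in `1..n`, as a predicate. -/
def RowOK (k n : ℕ) (T : Finset ((ℕ × ℕ) × ℕ)) : Prop :=
  (∀ i j e, ((i, j), e) ∈ T → i = 0 ∧ j < k ∧ 1 ≤ e ∧ e ≤ n) ∧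
  (∀ j, j < k → ∃ e, ((0, j), e) ∈ T) ∧
  (∀ j a b, ((0, j), a) ∈ T → ((0, j + 1), b) ∈ T → a ≤ b)

open Classical in
/-- The finite set of single-row tableaux. -/
noncomputable def RowT (k n : ℕ) : Finset (Finset ((ℕ × ℕ) × ℕ)) :=
  ((({0} : Finset ℕ) ×ˢ Finset.range k) ×ˢ Finset.Icc 1 n).powerset.filter (RowOK k n)

theorem mem_RowT (k n : ℕ) (T) : T ∈ RowT k n ↔ RowOK k n T := by
  classical
  unfold RowT
  rw [Finset.mem_filter, Finset.mem_powerset]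
  refine ⟨fun h => h.2, fun h => ⟨?_, h⟩⟩
  rintro ⟨⟨i, j⟩, e⟩ hx
  have := h.1 i j e hx
  simp only [Finset.mem_product, Finset.mem_singleton, Finset.mem_range, Finset.mem_Icc]
  tauto

theorem SVT_eq (k n : ℕ) (hn : 1 ≤ n) :
    SVT n (fun i => if i = 0 then k else 0) = RowT k n := by
  have hy : ∀ i j, (i, j) ∈ youngCells n (fun i => if i = 0 then k else 0) ↔ i = 0 ∧ j < k := by
    intro i j
    simp only [youngCells, Finset.mem_biUnion, Finset.mem_product, Finset.mem_singleton,
      Finset.mem_range]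
    constructor
    · rintro ⟨a, ha, rfl, h⟩
      split_ifs at h with h0
      · exact ⟨h0, h⟩
      · omega
    · rintro ⟨rfl, h⟩
      exact ⟨0, hn, rfl, by simpa using h⟩
  ext T
  rw [mem_RowT]
  unfold SVT RowOK
  rw [Finset.mem_filter, Finset.mem_powerset]
  constructor
  · rintro ⟨h0, h1, h2, h3⟩
    have hr : ∀ i j e, ((i, j), e) ∈ T → i = 0 ∧ j < k ∧ 1 ≤ e ∧ e ≤ n := by
      intro i j e h
      have := h0 h
      rw [Finset.mem_product, hy, Finset.mem_Icc] at this
      tauto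
    refine ⟨hr, ?_, ?_⟩
    · intro j hj
      obtain ⟨⟨p, e⟩, hx, rfl⟩ := h1 (0, j) ((hy 0 j).2 ⟨rfl, hj⟩)
      exact ⟨e, hx⟩
    · intro j a b ha hb
      exact h2 _ ha _ hb rfl rfl
  · rintro ⟨hr, h1, h2⟩
    refine ⟨?_, ?_, ?_, ?_⟩
    · rintro ⟨⟨i, j⟩, e⟩ hx
      have := hr i j e hx
      rw [Finset.mem_product, hy, Finset.mem_Icc]
      tauto
    · rintro ⟨i, j⟩ hp
      obtain ⟨rfl, hj⟩ := (hy i j).1 hp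
      obtain ⟨e, he⟩ := h1 j hj
      exact ⟨_, he, rfl⟩
    · rintro ⟨⟨i, j⟩, a⟩ hx ⟨⟨i', j'⟩, b⟩ hx' hi hj
      obtain ⟨rfl, -⟩ := hr _ _ _ hx
      obtain ⟨rfl, -⟩ := hr _ _ _ hx'
      simp only at hj
      subst hj
      exact h2 _ _ _ hx hx'
    · rintro ⟨⟨i, j⟩, a⟩ hx ⟨⟨i', j'⟩, b⟩ hx' hi hj
      have h1 := (hr _ _ _ hx).1
      have h2 := (hr _ _ _ hx').1
      simp only at hi
      omega

theorem RowOK.mono {k n : ℕ} {T} (h : RowOK k n T) :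
    ∀ d j a b, ((0, j), a) ∈ T → ((0, j + d + 1), b) ∈ T → a ≤ b := by
  intro d
  induction d with
  | zero => intro j a b; exact h.2.2 j a b
  | succ d ih =>
    intro j a b ha hb
    have := (h.1 _ _ _ hb).2.1
    obtain ⟨e, he⟩ := h.2.1 (j + d + 1) (by omega)
    exact (ih j a e ha he).trans (h.2.2 _ _ _ he hb)

theorem RowOK.mono' {k n : ℕ} {T} (h : RowOK k n T) {j j' a b : ℕ} (hj : j < j')
    (ha : ((0, j), a) ∈ T) (hb : ((0, j'), b) ∈ T) : a ≤ b := by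
  obtain ⟨d, rfl⟩ : ∃ d, j' = j + d + 1 := ⟨j' - j - 1, by omega⟩
  exact h.mono d j a b ha hb

theorem card_RowT_zero (n : ℕ) : (RowT 0 n).card = 1 := by
  rw [Finset.card_eq_one]
  refine ⟨∅, ?_⟩
  ext T
  rw [mem_RowT, Finset.mem_singleton]
  constructor
  · intro h
    rw [Finset.eq_empty_iff_forall_notMem]
    rintro ⟨⟨i, j⟩, e⟩ hx
    have := h.1 _ _ _ hx
    omega
  · rintro rfl
    simp [RowOK]

theorem card_RowT_succ_zero (k : ℕ) : (RowT (k + 1) 0).card = 0 := by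
  rw [Finset.card_eq_zero, Finset.eq_empty_iff_forall_notMem]
  intro T hT
  rw [mem_RowT] at hT
  obtain ⟨e, he⟩ := hT.2.1 0 (by omega)
  have := hT.1 _ _ _ he
  omega

/-- If box `k` has an entry `≤ n`, every other entry besides `n+1` in box `k` is `≤ n`. -/
theorem RowOK.erase_small {k n : ℕ} {T} (h : RowOK (k + 1) (n + 1) T) {e₀ : ℕ}
    (h0 : ((0, k), e₀) ∈ T) (hne : e₀ ≠ n + 1) :
    RowOK (k + 1) n (T.erase ((0, k), n + 1)) := by
  have he₀ := h.1 _ _ _ h0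
  refine ⟨?_, ?_, ?_⟩
  · intro i j e hx
    rw [Finset.mem_erase] at hx
    obtain ⟨hx1, hx⟩ := hx
    obtain ⟨rfl, hj, h1, h2⟩ := h.1 _ _ _ hx
    refine ⟨rfl, hj, h1, ?_⟩
    by_cases hjk : j = k
    · subst hjk
      have : e ≠ n + 1 := by rintro rfl; exact hx1 rfl
      omega
    · have := h.mono' (by omega : j < k) hx h0
      omega
  · intro j hj
    by_cases hjk : j = k
    · subst hjk
      exact ⟨e₀, by simp [hne, h0]⟩
    · obtain ⟨e, he⟩ := h.2.1 j hj
      exact ⟨e, by simp [hjk, he]⟩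
  · intro j a b ha hb
    exact h.2.2 j a b (Finset.mem_of_mem_erase ha) (Finset.mem_of_mem_erase hb)

theorem RowOK.erase_last {k n : ℕ} {T} (h : RowOK (k + 1) (n + 1) T)
    (h0 : ∀ e, ((0, k), e) ∈ T → e = n + 1) :
    RowOK k (n + 1) (T.erase ((0, k), n + 1)) := by
  refine ⟨?_, ?_, ?_⟩
  · intro i j e hx
    rw [Finset.mem_erase] at hx
    obtain ⟨hx1, hx⟩ := hx
    obtain ⟨rfl, hj, h1, h2⟩ := h.1 _ _ _ hx
    refine ⟨rfl, ?_, h1, h2⟩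
    by_cases hjk : j = k
    · subst hjk
      have := h0 _ hx
      subst this
      exact absurd rfl hx1
    · omega
  · intro j hj
    obtain ⟨e, he⟩ := h.2.1 j (by omega)
    exact ⟨e, by simp [hj.ne, he]⟩
  · intro j a b ha hb
    exact h.2.2 j a b (Finset.mem_of_mem_erase ha) (Finset.mem_of_mem_erase hb)

theorem RowOK.insert_aux {k n : ℕ} {T} (h : RowOK k (n + 1) T ∨ RowOK (k + 1) n T) :
    RowOK (k + 1) (n + 1) (insert ((0, k), n + 1) T) := by
  have hr : ∀ i j e, ((i, j), e) ∈ T → i = 0 ∧ j < k + 1 ∧ 1 ≤ e ∧ e ≤ n + 1 := by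
    intro i j e hx
    rcases h with h | h <;> have := h.1 _ _ _ hx <;> omega
  refine ⟨?_, ?_, ?_⟩
  · intro i j e hx
    rw [Finset.mem_insert] at hx
    rcases hx with hx | hx
    · simp only [Prod.mk.injEq] at hx
      omega
    · exact hr _ _ _ hx
  · intro j hj
    by_cases hjk : j = k
    · subst hjk
      exact ⟨n + 1, by simp⟩
    · obtain ⟨e, he⟩ : ∃ e, ((0, j), e) ∈ T := by
        rcases h with h | h <;> exact h.2.1 j (by omega)
      exact ⟨e, by simp [he]⟩
  · intro j a b ha hb
    rw [Finset.mem_insert] at ha hb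
    simp only [Prod.mk.injEq, true_and] at ha hb
    rcases hb with hb | hb
    · rcases ha with ha | ha
      · omega
      · have := hr _ _ _ ha
        omega
    · rcases ha with ha | ha
      · have := hr _ _ _ hb
        omega
      · rcases h with h | h <;> exact h.2.2 j a b ha hb

theorem card_RowT_succ_succ (k n : ℕ) :
    (RowT (k + 1) (n + 1)).card = (RowT k (n + 1)).card + 2 * (RowT (k + 1) n).card := by
  have hd : Disjoint (RowT k (n + 1)) (RowT (k + 1) n) := by
    rw [Finset.disjoint_left]
    intro T h1 h2
    rw [mem_RowT] at h1 h2
    obtain ⟨e, he⟩ := h2.2.1 k (by omega)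
    have := h1.1 _ _ _ he
    omega
  have hc : ∀ T ∈ RowT k (n + 1) ∪ RowT (k + 1) n, ((0, k), n + 1) ∉ T := by
    intro T hT hx
    rw [Finset.mem_union, mem_RowT, mem_RowT] at hT
    rcases hT with h | h <;> have := h.1 _ _ _ hx <;> omega
  have h1 : (RowT (k + 1) (n + 1)).filter (fun T => ((0, k), n + 1) ∈ T)
      = (RowT k (n + 1) ∪ RowT (k + 1) n).image (insert ((0, k), n + 1)) := by
    ext T
    simp only [Finset.mem_filter, Finset.mem_image, Finset.mem_union, mem_RowT]
    constructor
    · rintro ⟨h, hx⟩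
      refine ⟨T.erase ((0, k), n + 1), ?_, Finset.insert_erase hx⟩
      by_cases h0 : ∀ e, ((0, k), e) ∈ T → e = n + 1
      · exact Or.inl (h.erase_last h0)
      · push Not at h0
        obtain ⟨e, he, hne⟩ := h0
        exact Or.inr (h.erase_small he hne)
    · rintro ⟨U, hU, rfl⟩
      exact ⟨RowOK.insert_aux hU, Finset.mem_insert_self _ _⟩
  have h2 : (RowT (k + 1) (n + 1)).filter (fun T => ¬ ((0, k), n + 1) ∈ T)
      = RowT (k + 1) n := by
    ext T
    simp only [Finset.mem_filter, mem_RowT]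
    constructor
    · rintro ⟨h, hx⟩
      obtain ⟨e, he⟩ := h.2.1 k (by omega)
      have := h.erase_small he (by rintro rfl; exact hx he)
      rwa [Finset.erase_eq_of_notMem hx] at this
    · intro h
      refine ⟨⟨?_, h.2.1, h.2.2⟩, ?_⟩
      · intro i j e hx
        have := h.1 _ _ _ hx
        omega
      · intro hx
        have := h.1 _ _ _ hx
        omega
  rw [← Finset.card_filter_add_card_filter_not (fun T => ((0, k), n + 1) ∈ T), h1, h2,
    Finset.card_image_of_injOn, Finset.card_union_of_disjoint hd]
  · ring
  · intro U hU V hV hUV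
    rw [← Finset.erase_insert (hc U hU), ← Finset.erase_insert (hc V hV), hUV]

theorem card_RowT (k n : ℕ) : (RowT (k + 1) n).card
    = ∑ m ∈ Finset.range n, (n + k).choose (k + 1 + m) * (k + m).choose m := by
  induction k generalizing n with
  | zero =>
    induction n with
    | zero => simp [card_RowT_succ_zero]
    | succ n ih =>
      rw [card_RowT_succ_succ, ih, card_RowT_zero]
      have e1 : ∀ m, (n + 1 + 0).choose (0 + 1 + m) * (0 + m).choose m
          = n.choose m + n.choose (m + 1) := by
        intro m
        rw [show 0 + 1 + m = m + 1 by omega, show n + 1 + 0 = n + 1 by omega,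
          Nat.choose_succ_succ]
        simp
      have e2 : ∀ m, (n + 0).choose (0 + 1 + m) * (0 + m).choose m
          = n.choose (m + 1) := by
        intro m
        rw [show 0 + 1 + m = m + 1 by omega]
        simp
      simp only [e1, e2]
      rw [Finset.sum_add_distrib, Finset.sum_range_succ' (fun m => n.choose m),
        Finset.sum_range_succ (fun m => n.choose (m + 1))]
      simp
      ring
  | succ k ihk =>
    induction n with
    | zero => simp [card_RowT_succ_zero]
    | succ n ih =>
      rw [card_RowT_succ_succ, ih, ihk]
      have e1 : ∀ m, (n + 1 + (k + 1)).choose (k + 1 + 1 + m) * (k + 1 + m).choose m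
          = (n + 1 + k).choose (k + 1 + m) * (k + 1 + m).choose m
            + (n + (k + 1)).choose (k + 1 + 1 + m) * (k + 1 + m).choose m := by
        intro m
        rw [show k + 1 + 1 + m = (k + 1 + m) + 1 by omega,
          show n + 1 + (k + 1) = (n + 1 + k) + 1 by omega, Nat.choose_succ_succ, add_mul,
          show n + (k + 1) = n + 1 + k by omega]
      have e2 : ∑ m ∈ Finset.range (n + 1), (n + 1 + k).choose (k + 1 + m) * (k + 1 + m).choose m
          = ∑ m ∈ Finset.range (n + 1), (n + 1 + k).choose (k + 1 + m) * (k + m).choose m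
            + ∑ m ∈ Finset.range n,
              (n + (k + 1)).choose (k + 1 + 1 + m) * (k + 1 + m).choose m := by
        rw [Finset.sum_range_succ', Finset.sum_range_succ' _ n,
          add_right_comm (Finset.sum _ _) _ (Finset.sum _ _), ← Finset.sum_add_distrib]
        congr 1
        swap
        · simp
        apply Finset.sum_congr rfl
        intro m _
        rw [show k + 1 + (m + 1) = (k + 1 + m) + 1 by omega,
          show k + (m + 1) = k + 1 + m by omega, Nat.choose_succ_succ (k + 1 + m) m,
          show k + 1 + 1 + m = k + 1 + m + 1 by omega, show n + (k + 1) = n + 1 + k by omega]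
        simp only [Nat.succ_eq_add_one]
        ring
      simp only [e1]
      rw [Finset.sum_add_distrib, e2, Finset.sum_range_succ
        (fun m => (n + (k + 1)).choose (k + 1 + 1 + m) * (k + 1 + m).choose m),
        Nat.choose_eq_zero_of_lt (by omega : n + (k + 1) < k + 1 + 1 + n)]
      ring

/-- For `k, n ≥ 1`, the number of set-valued tableaux of single-row
shape `(k)` with entries in `{1, …, n}` is
`|SVT((k),n)| = C(n+k-1,k) · Σ_{m=0}^{n-1} (k/(k+m)) C(n-1,m)`. -/
theorem card_SVT_single_row (k n : ℕ) (hk : 1 ≤ k) (hn : 1 ≤ n) :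
    (((SVT n (fun i => if i = 0 then k else 0)).card : ℚ))
      = ((n + k - 1).choose k : ℚ) *
        ∑ m ∈ Finset.range n, (k : ℚ) / ((k : ℚ) + (m : ℚ)) * (((n - 1).choose m : ℚ)) := by
  rw [SVT_eq k n hn]
  obtain ⟨k, rfl⟩ : ∃ k', k = k' + 1 := ⟨k - 1, by omega⟩
  obtain ⟨n, rfl⟩ : ∃ n', n = n' + 1 := ⟨n - 1, by omega⟩
  rw [card_RowT, Nat.cast_sum, Finset.mul_sum]
  apply Finset.sum_congr rfl
  intro m hm
  rw [Finset.mem_range] at hm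
  obtain ⟨d, rfl⟩ : ∃ d, n = m + d := ⟨n - m, by omega⟩
  rw [show m + d + 1 + (k + 1) - 1 = m + d + k + 1 by omega, Nat.add_sub_cancel,
    show m + d + 1 + k = m + d + k + 1 by omega, Nat.cast_mul,
    Nat.cast_choose ℚ (by omega : k + 1 + m ≤ m + d + k + 1),
    Nat.cast_choose ℚ (by omega : m ≤ k + m),
    Nat.cast_choose ℚ (by omega : k + 1 ≤ m + d + k + 1),
    Nat.cast_choose ℚ (by omega : m ≤ m + d),
    show m + d + k + 1 - (k + 1 + m) = d by omega, show k + m - m = k by omega,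
    show m + d + k + 1 - (k + 1) = m + d by omega, show m + d - m = d by omega,
    show k + 1 + m = (k + m) + 1 by omega, Nat.factorial_succ (k + m), Nat.factorial_succ k]
  have h1 := fun a : ℕ => (Nat.cast_ne_zero (R := ℚ)).2 (Nat.factorial_ne_zero a)
  have a1 := h1 (k + m)
  have a2 := h1 k
  have a3 := h1 m
  have a4 := h1 d
  have a5 := h1 (m + d)
  have a6 : ((k : ℚ) + 1 + m) ≠ 0 := by positivity
  have a7 : ((k : ℚ) + m + 1) ≠ 0 := by positivity
  have a8 : ((k : ℚ) + 1) ≠ 0 := by positivity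
  push_cast
  field_simp
  ring
end

section
/- Fix integers n ≥ 1 and 1 ≤ k ≤ n. The number of set-valued tableaux of single-column shape (1^k) with entries in {1,…,n} is |SVT((1^k), n)| = C(n, k) · Σ_{m=0}^{n−k} (k/(k+m)) · C(n−k, m). (The sum equals the terminating Gauss hypergeometric value ₂F₁(k, k−n; k+1; −1).) -/
open Finset

/-- Column tableaux with `k` rows and entries in `{1, …, N}` (decoupled bounds). -/
def colP (N k : ℕ) (T : Finset ((ℕ × ℕ) × ℕ)) : Prop :=
  (∀ i j e, ((i, j), e) ∈ T → i < k ∧ j = 0 ∧ 1 ≤ e ∧ e ≤ N) ∧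
  (∀ i, i < k → ∃ e, ((i, 0), e) ∈ T) ∧
  (∀ i e e', ((i, 0), e) ∈ T → ((i + 1, 0), e') ∈ T → e < e')

open Classical in
noncomputable def colE (N k : ℕ) : Finset (Finset ((ℕ × ℕ) × ℕ)) :=
  ((Finset.range k ×ˢ {0}) ×ˢ Finset.Icc 1 N).powerset.filter (colP N k)

theorem mem_colE (N k : ℕ) (T : Finset ((ℕ × ℕ) × ℕ)) : T ∈ colE N k ↔ colP N k T := by
  unfold colE
  classical
  rw [Finset.mem_filter, Finset.mem_powerset]
  refine ⟨fun h => h.2, fun h => ⟨?_, h⟩⟩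
  rintro ⟨⟨i, j⟩, e⟩ hx
  have := h.1 i j e hx
  simp
  omega

theorem SVT_eq_colE (n k : ℕ) (hkn : k ≤ n) :
    SVT n (fun i => if i < k then 1 else 0) = colE n k := by
  have hc : ∀ i j, (i, j) ∈ youngCells n (fun i => if i < k then 1 else 0) ↔ i < k ∧ j = 0 := by
    intro i j
    simp only [youngCells, Finset.mem_biUnion, Finset.mem_product, Finset.mem_singleton,
      Finset.mem_range]
    constructor
    · rintro ⟨a, ha, rfl, h⟩
      split_ifs at h <;> omega
    · rintro ⟨h, rfl⟩
      exact ⟨i, by omega, rfl, by simp [h]⟩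
  ext T
  rw [mem_colE]
  unfold SVT
  rw [Finset.mem_filter, Finset.mem_powerset]
  constructor
  · rintro ⟨hs, h1, -, h3⟩
    refine ⟨?_, ?_, ?_⟩
    · intro i j e h
      have := hs h
      rw [Finset.mem_product, hc, Finset.mem_Icc] at this
      exact ⟨this.1.1, this.1.2, this.2⟩
    · intro i hi
      obtain ⟨⟨p, e⟩, hx, hp⟩ := h1 (i, 0) ((hc _ _).2 ⟨hi, rfl⟩)
      simp only at hp
      subst hp
      exact ⟨e, hx⟩
    · intro i e e' h h'
      exact h3 _ h _ h' rfl rfl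
  · rintro ⟨h0, h1, h2⟩
    refine ⟨?_, ?_, ?_, ?_⟩
    · rintro ⟨⟨i, j⟩, e⟩ hx
      have := h0 i j e hx
      rw [Finset.mem_product, hc, Finset.mem_Icc]
      exact ⟨⟨this.1, this.2.1⟩, this.2.2⟩
    · rintro ⟨i, j⟩ hp
      obtain ⟨hi, rfl⟩ := (hc _ _).1 hp
      obtain ⟨e, he⟩ := h1 i hi
      exact ⟨_, he, rfl⟩
    · rintro ⟨⟨i, j⟩, e⟩ hx ⟨⟨i', j'⟩, e'⟩ hy - h
      have a := h0 _ _ _ hx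
      have b := h0 _ _ _ hy
      simp only at h
      omega
    · rintro ⟨⟨i, j⟩, e⟩ hx ⟨⟨i', j'⟩, e'⟩ hy h h'
      have a := h0 _ _ _ hx
      have b := h0 _ _ _ hy
      simp only at h h' ⊢
      obtain ⟨-, rfl, -⟩ := a
      subst h h'
      exact h2 _ _ _ hx hy

theorem colE_zero_right (N : ℕ) : (colE N 0).card = 1 := by
  rw [Finset.card_eq_one]
  refine ⟨∅, ?_⟩
  ext T
  rw [mem_colE, Finset.mem_singleton]
  constructor
  · rintro ⟨h, -, -⟩
    rw [Finset.eq_empty_iff_forall_notMem]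
    rintro ⟨⟨i, j⟩, e⟩ hx
    have := h _ _ _ hx
    omega
  · rintro rfl
    simp [colP]

theorem colE_zero_left (k : ℕ) : (colE 0 (k + 1)).card = 0 := by
  rw [Finset.card_eq_zero, Finset.eq_empty_iff_forall_notMem]
  intro T hT
  rw [mem_colE] at hT
  obtain ⟨h0, h1, -⟩ := hT
  obtain ⟨e, he⟩ := h1 0 (by omega)
  have := h0 _ _ _ he
  omega

theorem colE_step (N k : ℕ) : colE (N + 1) (k + 1) =
    colE N (k + 1) ∪ (colE N (k + 1) ∪ colE N k).image (insert ((k, 0), N + 1)) := by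
  ext T
  simp only [Finset.mem_union, Finset.mem_image, mem_colE]
  constructor
  · rintro ⟨h0, h1, h2⟩
    have top : ∀ i j, ((i, j), N + 1) ∈ T → i = k ∧ j = 0 := by
      intro i j h
      have a := h0 _ _ _ h
      obtain ⟨a1, rfl, -⟩ := a
      refine ⟨?_, rfl⟩
      by_contra hne
      obtain ⟨e', he'⟩ := h1 (i + 1) (by omega)
      have b := h0 _ _ _ he'
      have c := h2 _ _ _ h he'
      omega
    by_cases hT : ((k, 0), N + 1) ∈ T
    · right
      refine ⟨T.erase ((k, 0), N + 1), ?_, Finset.insert_erase hT⟩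
      have low : ∀ i j e, ((i, j), e) ∈ T.erase ((k, 0), N + 1) →
          i < k + 1 ∧ j = 0 ∧ 1 ≤ e ∧ e ≤ N := by
        intro i j e h
        rw [Finset.mem_erase] at h
        have a := h0 _ _ _ h.2
        refine ⟨a.1, a.2.1, a.2.2.1, ?_⟩
        by_contra hn
        obtain rfl : e = N + 1 := by omega
        obtain ⟨rfl, rfl⟩ := top _ _ h.2
        exact h.1 rfl
      have rows : ∀ i, i < k → ∃ e, ((i, 0), e) ∈ T.erase ((k, 0), N + 1) := by
        intro i hi
        obtain ⟨e, he⟩ := h1 i (by omega)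
        refine ⟨e, Finset.mem_erase.2 ⟨?_, he⟩⟩
        intro h
        simp only [Prod.mk.injEq] at h
        omega
      have mono : ∀ i e e', ((i, 0), e) ∈ T.erase ((k, 0), N + 1) →
          ((i + 1, 0), e') ∈ T.erase ((k, 0), N + 1) → e < e' := fun i e e' h h' =>
        h2 i e e' (Finset.mem_of_mem_erase h) (Finset.mem_of_mem_erase h')
      by_cases hk : ∃ e, ((k, 0), e) ∈ T.erase ((k, 0), N + 1)
      · left
        refine ⟨low, ?_, mono⟩
        intro i hi
        rcases Nat.lt_succ_iff_lt_or_eq.1 hi with h | rfl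
        · exact rows i h
        · exact hk
      · right
        refine ⟨?_, rows, mono⟩
        intro i j e h
        have a := low _ _ _ h
        refine ⟨?_, a.2⟩
        by_contra hn
        obtain rfl : i = k := by omega
        obtain ⟨-, rfl, -⟩ := a
        exact hk ⟨e, h⟩
    · left
      refine ⟨?_, h1, h2⟩
      intro i j e h
      have a := h0 _ _ _ h
      refine ⟨a.1, a.2.1, a.2.2.1, ?_⟩
      by_contra hn
      obtain rfl : e = N + 1 := by omega
      obtain ⟨rfl, rfl⟩ := top _ _ h
      exact hT h
  · have key : ∀ S, (∀ i j e, ((i, j), e) ∈ S → i < k + 1 ∧ j = 0 ∧ 1 ≤ e ∧ e ≤ N) →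
        (∀ i, i < k → ∃ e, ((i, 0), e) ∈ S) →
        (∀ i e e', ((i, 0), e) ∈ S → ((i + 1, 0), e') ∈ S → e < e') →
        colP (N + 1) (k + 1) (insert ((k, 0), N + 1) S) := by
      intro S h0 h1 h2
      refine ⟨?_, ?_, ?_⟩
      · intro i j e h
        rcases Finset.mem_insert.1 h with h | h
        · simp only [Prod.mk.injEq] at h
          omega
        · have := h0 _ _ _ h
          omega
      · intro i hi
        rcases Nat.lt_succ_iff_lt_or_eq.1 hi with h | rfl
        · obtain ⟨e, he⟩ := h1 i h
          exact ⟨e, Finset.mem_insert_of_mem he⟩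
        · exact ⟨N + 1, Finset.mem_insert_self _ _⟩
      · intro i e e' h h'
        rcases Finset.mem_insert.1 h with h | h <;> rcases Finset.mem_insert.1 h' with h' | h'
        · simp only [Prod.mk.injEq] at h h'
          omega
        · simp only [Prod.mk.injEq] at h
          have := h0 _ _ _ h'
          omega
        · simp only [Prod.mk.injEq] at h'
          have := h0 _ _ _ h
          omega
        · exact h2 _ _ _ h h'
    rintro (⟨h0, h1, h2⟩ | ⟨S, (⟨h0, h1, h2⟩ | ⟨h0, h1, h2⟩), rfl⟩)
    · refine ⟨fun i j e h => ?_, h1, h2⟩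
      have := h0 _ _ _ h
      omega
    · exact key S h0 (fun i hi => h1 i (by omega)) h2
    · refine key S (fun i j e h => ?_) h1 h2
      have := h0 _ _ _ h
      omega

theorem colE_card_step (N k : ℕ) :
    (colE (N + 1) (k + 1)).card = 2 * (colE N (k + 1)).card + (colE N k).card := by
  have fresh : ∀ S ∈ colE N (k + 1) ∪ colE N k, ((k, 0), N + 1) ∉ S := by
    intro S hS h
    rw [Finset.mem_union, mem_colE, mem_colE] at hS
    rcases hS with hS | hS <;> have := hS.1 _ _ _ h <;> omega
  rw [colE_step, Finset.card_union_of_disjoint, Finset.card_image_of_injOn,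
    Finset.card_union_of_disjoint]
  · ring
  · rw [Finset.disjoint_left]
    intro S h h'
    rw [mem_colE] at h h'
    obtain ⟨e, he⟩ := h.2.1 k (by omega)
    have := h'.1 _ _ _ he
    omega
  · intro S hS S' hS' h
    rw [← Finset.erase_insert (fresh S hS), ← Finset.erase_insert (fresh S' hS')]
    exact congrArg (fun X => Finset.erase X ((k, 0), N + 1)) h
  · rw [Finset.disjoint_left]
    intro S h h'
    obtain ⟨S', -, rfl⟩ := Finset.mem_image.1 h'
    exact fresh _ (Finset.mem_union_left _ h) (Finset.mem_insert_self _ _)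

theorem colE_card (N k : ℕ) :
    (colE N (k + 1)).card = ∑ j ∈ Finset.range N, N.choose (j + 1) * j.choose k := by
  induction N generalizing k with
  | zero => simp [colE_zero_left]
  | succ N ih =>
    have e : ∑ j ∈ Finset.range (N + 1), (N + 1).choose (j + 1) * j.choose k
        = (∑ j ∈ Finset.range N, N.choose (j + 1) * (j + 1).choose k + (0).choose k)
          + ∑ j ∈ Finset.range N, N.choose (j + 1) * j.choose k := by
      have : ∀ j, (N + 1).choose (j + 1) * j.choose k
          = N.choose j * j.choose k + N.choose (j + 1) * j.choose k := by
        intro j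
        rw [Nat.choose_succ_succ']
        ring
      simp only [this]
      rw [Finset.sum_add_distrib, Finset.sum_range_succ', Finset.sum_range_succ
        (fun j => N.choose (j + 1) * j.choose k)]
      simp
    rw [colE_card_step, e, ih]
    cases k with
    | zero =>
      rw [colE_zero_right]
      simp
      ring
    | succ k =>
      rw [ih]
      simp only [Nat.choose_succ_succ' _ k, mul_add, Finset.sum_add_distrib]
      simp
      ring

/-- For `n ≥ 1` and `1 ≤ k ≤ n`, the number of set-valued tableaux of
single-column shape `(1^k)` with entries in `{1, …, n}` is
`|SVT((1^k),n)| = C(n,k) · Σ_{m=0}^{n-k} (k/(k+m)) C(n-k,m)`. -/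
theorem card_SVT_single_column (n k : ℕ) (hk : 1 ≤ k) (hkn : k ≤ n) :
    (((SVT n (fun i => if i < k then 1 else 0)).card : ℚ))
      = (n.choose k : ℚ) *
        ∑ m ∈ Finset.range (n - k + 1),
          (k : ℚ) / ((k : ℚ) + (m : ℚ)) * (((n - k).choose m : ℚ)) := by
  rw [SVT_eq_colE n k hkn]
  obtain ⟨k, rfl⟩ : ∃ l, k = l + 1 := ⟨k - 1, by omega⟩
  obtain ⟨d, rfl⟩ : ∃ d, n = k + 1 + d := ⟨n - (k + 1), by omega⟩
  rw [colE_card, show k + 1 + d = k + (d + 1) by ring, Finset.sum_range_add,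
    Finset.sum_eq_zero (s := Finset.range k), zero_add,
    show k + (d + 1) - (k + 1) = d by omega, Finset.mul_sum, Nat.cast_sum]
  · refine Finset.sum_congr rfl fun m hm => ?_
    have hm' : m ≤ d := by
      have := Finset.mem_range.1 hm
      omega
    have h1 := Nat.choose_mul (n := k + (d + 1)) (k := k + m + 1) (s := k + 1)
      (by omega)
    rw [show k + (d + 1) - (k + 1) = d by omega, show k + m + 1 - (k + 1) = m by omega] at h1
    have h2 := Nat.add_one_mul_choose_eq (k + m) k
    have h1' : ((k + (d + 1)).choose (k + m + 1) : ℚ) * (k + m + 1).choose (k + 1)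
      = (k + (d + 1)).choose (k + 1) * d.choose m := by exact_mod_cast h1
    have h2' : ((k : ℚ) + m + 1) * (k + m).choose k
      = (k + m + 1).choose (k + 1) * (k + 1) := by exact_mod_cast h2
    have h3 : (k : ℚ) + 1 + m ≠ 0 := by positivity
    push_cast
    rw [div_mul_eq_mul_div, mul_div_assoc', eq_div_iff h3]
    linear_combination ((k + (d + 1)).choose (k + m + 1) : ℚ) * h2' + ((k : ℚ) + 1) * h1'
  · intro j hj
    rw [Nat.choose_eq_zero_of_lt (Finset.mem_range.1 hj), mul_zero]
end

section
/- Let n ≥ 1 and let λ = (λ_1 ≥ λ_2 ≥ … ≥ λ_n ≥ 0) be a partition (padded with zeros to length n). Then, as an identity of polynomials in β with rational coefficients: Σ_{T ∈ SVT(λ, n)} β^{|T| − |λ|} = Σ_{k_1=0}^{0} Σ_{k_2=0}^{1} ⋯ Σ_{k_n=0}^{n−1} C(0, k_1) C(1, k_2) ⋯ C(n−1, k_n) · β^{k_1 + ⋯ + k_n} · ∏_{1≤i<j≤n} (λ_i − λ_j + k_i − k_j + j − i)/(j − i). (Equivalently, G_λ(1, 1, …, 1 | β) = |SST(λ,n)|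 · F^{(n)}, where F^{(n)} is Holman's hypergeometric function with parameter matrix A_{ij} = λ_i − λ_j + j − i, numerator parameters 0, −1, …, −(n−1), denominator parameters all 1, and all arguments −β.) -/
open Finset

theorem mem_youngCells (n : ℕ) (lam : ℕ → ℕ) (i j : ℕ) :
    (i, j) ∈ youngCells n lam ↔ i < n ∧ j < lam i := by
  simp only [youngCells, mem_biUnion, mem_range, mem_product, mem_singleton]
  constructor
  · rintro ⟨a, ha, rfl, hj⟩
    exact ⟨ha, hj⟩
  · rintro ⟨h1, h2⟩
    exact ⟨i, h1, rfl, h2⟩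

theorem card_youngCells (n : ℕ) (lam : ℕ → ℕ) :
    (youngCells n lam).card = ∑ i ∈ Finset.range n, lam i := by
  unfold youngCells
  rw [Finset.card_biUnion]
  · simp
  · intro a _ b _ hab
    rw [Function.onFun, Finset.disjoint_left]
    rintro ⟨i, j⟩ h1 h2
    simp only [mem_product, mem_singleton] at h1 h2
    exact hab (h1.1.symm.trans h2.1)

theorem mem_SVT (n : ℕ) (lam : ℕ → ℕ) (T : Finset ((ℕ × ℕ) × ℕ)) :
    T ∈ SVT n lam ↔
      (∀ i j e, ((i, j), e) ∈ T → i < n ∧ j < lam i ∧ 1 ≤ e ∧ e ≤ n) ∧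
      (∀ i j, i < n → j < lam i → ∃ e, ((i, j), e) ∈ T) ∧
      (∀ i j e f, ((i, j), e) ∈ T → ((i, j + 1), f) ∈ T → e ≤ f) ∧
      (∀ i j e f, ((i, j), e) ∈ T → ((i + 1, j), f) ∈ T → e < f) := by
  unfold SVT
  rw [mem_filter, mem_powerset]
  refine and_congr ?_ (and_congr ?_ (and_congr ?_ ?_))
  · constructor
    · intro h i j e hx
      have := h hx
      rw [mem_product, mem_youngCells, mem_Icc] at this
      exact ⟨this.1.1, this.1.2, this.2.1, this.2.2⟩
    · rintro h ⟨⟨i, j⟩, e⟩ hx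
      rw [mem_product, mem_youngCells, mem_Icc]
      have := h i j e hx
      exact ⟨⟨this.1, this.2.1⟩, this.2.2⟩
  · constructor
    · intro h i j hi hj
      obtain ⟨⟨p, e⟩, hx, rfl⟩ := h (i, j) ((mem_youngCells _ _ _ _).2 ⟨hi, hj⟩)
      exact ⟨e, hx⟩
    · rintro h ⟨i, j⟩ hp
      rw [mem_youngCells] at hp
      obtain ⟨e, he⟩ := h i j hp.1 hp.2
      exact ⟨_, he, rfl⟩
  · constructor
    · intro h i j e f hx hy
      exact h _ hx _ hy rfl rfl
    · rintro h ⟨⟨i, j⟩, e⟩ hx ⟨⟨i', j'⟩, f⟩ hy h1 h2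
      simp only at h1 h2
      subst h1 h2
      exact h _ _ _ _ hx hy
  · constructor
    · intro h i j e f hx hy
      exact h _ hx _ hy rfl rfl
    · rintro h ⟨⟨i, j⟩, e⟩ hx ⟨⟨i', j'⟩, f⟩ hy h1 h2
      simp only at h1 h2
      subst h1 h2
      exact h _ _ _ _ hx hy

theorem SVT_card_ge (n : ℕ) (lam : ℕ → ℕ) (T : Finset ((ℕ × ℕ) × ℕ)) (hT : T ∈ SVT n lam) :
    ∑ i ∈ Finset.range n, lam i ≤ T.card := by
  rw [mem_SVT] at hT
  rw [← card_youngCells]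
  refine le_trans (Finset.card_le_card ?_) (Finset.card_image_le (s := T) (f := Prod.fst))
  rintro ⟨i, j⟩ h
  rw [mem_youngCells] at h
  obtain ⟨e, he⟩ := hT.2.1 i j h.1 h.2
  exact mem_image.2 ⟨_, he, rfl⟩

/-- entries in row `i` are at least `i + 1` -/
theorem SVT_row_ge (n : ℕ) (lam : ℕ → ℕ) (hdec : ∀ i j : ℕ, i ≤ j → lam j ≤ lam i)
    (T : Finset ((ℕ × ℕ) × ℕ)) (hT : T ∈ SVT n lam) :
    ∀ i j e, ((i, j), e) ∈ T → i + 1 ≤ e := by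
  rw [mem_SVT] at hT
  obtain ⟨ha, hb, hc, hd⟩ := hT
  intro i
  induction i with
  | zero => intro j e h; have := ha _ _ _ h; omega
  | succ i ih =>
    intro j e h
    have h1 := ha _ _ _ h
    have h2 := hdec i (i + 1) (by omega)
    obtain ⟨f, hf⟩ := hb i j (by omega) (by omega)
    have := ih _ _ hf
    have := hd _ _ _ _ hf h
    omega

/-- extension by zero -/
def extZ (n : ℕ) (m : Fin n → ℕ) : ℕ → ℕ := fun i => if h : i < n then m ⟨i, h⟩ else 0

theorem extZ_lt (n : ℕ) (m : Fin n → ℕ) (i : Fin n) : extZ n m i = m i := by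
  simp [extZ]

theorem extZ_ge (n : ℕ) (m : Fin n → ℕ) (i : ℕ) (h : n ≤ i) : extZ n m i = 0 := by
  simp [extZ, Nat.not_lt.2 h]

def glue (n : ℕ) (lam mu : ℕ → ℕ) (S : Finset ℕ) (T : Finset ((ℕ × ℕ) × ℕ)) :
    Finset ((ℕ × ℕ) × ℕ) :=
  (T ∪ ((youngCells (n + 1) lam \ youngCells n mu) ×ˢ {n + 1})) ∪
    S.image (fun i => ((i, mu i - 1), n + 1))

theorem mem_glue (n : ℕ) (lam mu : ℕ → ℕ) (S : Finset ℕ) (T : Finset ((ℕ × ℕ) × ℕ))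
    (hmu : mu n = 0) (hS : ∀ i ∈ S, 0 < mu i) (i j e : ℕ) :
    ((i, j), e) ∈ glue n lam mu S T ↔
      ((i, j), e) ∈ T ∨ (e = n + 1 ∧ i < n + 1 ∧ mu i ≤ j ∧ j < lam i) ∨
        (e = n + 1 ∧ i ∈ S ∧ j + 1 = mu i) := by
  unfold glue
  rw [mem_union, mem_union, mem_product, mem_sdiff, mem_singleton, mem_youngCells, mem_youngCells,
    mem_image, or_assoc]
  refine or_congr Iff.rfl (or_congr ?_ ?_)
  · constructor
    · rintro ⟨⟨⟨h1, h2⟩, h3⟩, h4⟩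
      refine ⟨h4, h1, ?_, h2⟩
      by_contra hlt
      rcases Nat.lt_succ_iff_lt_or_eq.1 h1 with h | h
      · exact h3 ⟨h, by omega⟩
      · subst h; omega
    · rintro ⟨h1, h2, h3, h4⟩
      exact ⟨⟨⟨h2, h4⟩, fun h => by omega⟩, h1⟩
  · constructor
    · rintro ⟨a, ha, h⟩
      simp only [Prod.mk.injEq] at h
      obtain ⟨⟨rfl, rfl⟩, rfl⟩ := h
      have := hS a ha
      exact ⟨rfl, ha, by omega⟩
    · rintro ⟨rfl, h1, h2⟩
      refine ⟨i, h1, ?_⟩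
      simp only [Prod.mk.injEq, true_and, and_true]
      omega

theorem glue_mem (n : ℕ) (lam mu : ℕ → ℕ) (hdec : ∀ i j : ℕ, i ≤ j → lam j ≤ lam i)
    (hInterl : ∀ i < n, lam (i + 1) ≤ mu i ∧ mu i ≤ lam i) (hmu : mu n = 0)
    (S : Finset ℕ) (hS : ∀ i ∈ S, i < n ∧ lam (i + 1) < mu i) (T : Finset ((ℕ × ℕ) × ℕ))
    (hT : T ∈ SVT n mu) : glue n lam mu S T ∈ SVT (n + 1) lam := by
  have hmem := mem_glue n lam mu S T hmu (fun i hi => by have := hS i hi; omega)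
  rw [mem_SVT] at hT ⊢
  obtain ⟨ha, hb, hc, hd⟩ := hT
  have A : ∀ i j e, ((i, j), e) ∈ glue n lam mu S T →
      i < n + 1 ∧ j < lam i ∧ 1 ≤ e ∧ e ≤ n + 1 := by
    intro i j e h
    rw [hmem] at h
    rcases h with h | h | h
    · have h1 := ha _ _ _ h
      have h2 := hInterl i h1.1
      omega
    · omega
    · have h1 := hS i h.2.1
      have h2 := hInterl i h1.1
      omega
  refine ⟨A, ?_, ?_, ?_⟩
  · intro i j hi hj
    by_cases h : j < mu i
    · have hin : i < n := by
        rcases Nat.lt_succ_iff_lt_or_eq.1 hi with h' | h'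
        · exact h'
        · subst h'; omega
      obtain ⟨e, he⟩ := hb i j hin h
      exact ⟨e, (hmem _ _ _).2 (Or.inl he)⟩
    · exact ⟨n + 1, (hmem _ _ _).2 (Or.inr (Or.inl ⟨rfl, hi, by omega, hj⟩))⟩
  · intro i j e f hx hy
    have h1 := A _ _ _ hx
    rw [hmem] at hx hy
    rcases hy with hy | hy | hy
    · have h2 := ha _ _ _ hy
      rcases hx with hx | hx | hx
      · exact hc _ _ _ _ hx hy
      · omega
      · omega
    · omega
    · omega
  · intro i j e f hx hy
    have h1 := A _ _ _ hy
    have h2 := hInterl i (by omega)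
    rw [hmem] at hx
    rcases hx with hx | hx | hx
    · rw [hmem] at hy
      have := ha _ _ _ hx
      rcases hy with hy | hy | hy
      · exact hd _ _ _ _ hx hy
      · omega
      · omega
    · omega
    · have := hS i hx.2.1
      omega

theorem glue_filter (n : ℕ) (lam mu : ℕ → ℕ) (hmu : mu n = 0)
    (S : Finset ℕ) (hS : ∀ i ∈ S, i < n ∧ lam (i + 1) < mu i) (T : Finset ((ℕ × ℕ) × ℕ))
    (hT : T ∈ SVT n mu) : (glue n lam mu S T).filter (fun x => x.2 ≤ n) = T := by
  have hmem := mem_glue n lam mu S T hmu (fun i hi => by have := hS i hi; omega)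
  rw [mem_SVT] at hT
  ext ⟨⟨i, j⟩, e⟩
  rw [mem_filter, hmem]
  constructor
  · rintro ⟨h | h | h, h'⟩
    · exact h
    · simp only at h'; omega
    · simp only at h'; omega
  · intro h
    exact ⟨Or.inl h, (hT.1 _ _ _ h).2.2.2⟩

theorem glue_card (n : ℕ) (lam mu : ℕ → ℕ)
    (hInterl : ∀ i < n, lam (i + 1) ≤ mu i ∧ mu i ≤ lam i)
    (S : Finset ℕ) (hS : ∀ i ∈ S, i < n ∧ lam (i + 1) < mu i) (T : Finset ((ℕ × ℕ) × ℕ))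
    (hT : T ∈ SVT n mu) :
    (glue n lam mu S T).card - ∑ i ∈ Finset.range (n + 1), lam i =
      (T.card - ∑ i ∈ Finset.range n, mu i) + S.card := by
  have hge := SVT_card_ge _ _ _ hT
  rw [mem_SVT] at hT
  have hsub : youngCells n mu ⊆ youngCells (n + 1) lam := by
    rintro ⟨i, j⟩ h
    rw [mem_youngCells] at h ⊢
    have := hInterl i h.1
    omega
  have hle := Finset.card_le_card hsub
  unfold glue
  rw [Finset.card_union_of_disjoint, Finset.card_union_of_disjoint, Finset.card_product,
    Finset.card_sdiff_of_subset hsub, Finset.card_image_of_injOn, Finset.card_singleton,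
    card_youngCells, card_youngCells]
  · rw [card_youngCells, card_youngCells] at hle
    omega
  · intro a _ b _ h
    simp only [Prod.mk.injEq] at h
    exact h.1.1
  · rw [Finset.disjoint_left]
    rintro ⟨⟨i, j⟩, e⟩ h1 h2
    rw [mem_product, mem_singleton] at h2
    have := hT.1 _ _ _ h1
    simp only at h2
    omega
  · rw [Finset.disjoint_left]
    rintro ⟨⟨i, j⟩, e⟩ h1 h2
    rw [mem_image] at h2
    obtain ⟨a, ha, h⟩ := h2
    simp only [Prod.mk.injEq] at h
    obtain ⟨⟨rfl, rfl⟩, rfl⟩ := h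
    have h3 := hS a ha
    rw [mem_union] at h1
    rcases h1 with h1 | h1
    · have := hT.1 _ _ _ h1
      omega
    · rw [mem_product, mem_sdiff, mem_youngCells, mem_youngCells] at h1
      exact h1.1.2 ⟨h3.1, by omega⟩

theorem lower_exists (L : ℕ) (P : ℕ → Prop) (hP : ∀ j, P (j + 1) → P j)
    (hL : ∀ j, P j → j < L) : ∃ m, ∀ j, j < m ↔ P j := by
  classical
  have hex : ∃ j, ¬ P j := ⟨L, fun h => lt_irrefl _ (hL L h)⟩
  refine ⟨Nat.find hex, fun j => ⟨fun h => ?_, fun h => ?_⟩⟩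
  · by_contra h'
    exact absurd (Nat.find_min' hex h') (by omega)
  · by_contra hlt
    have key : ∀ d, ¬ P (Nat.find hex + d) := by
      intro d
      induction d with
      | zero => exact Nat.find_spec hex
      | succ d ih => exact fun h => ih (hP _ h)
    have := key (j - Nat.find hex)
    rw [Nat.add_sub_cancel' (by omega)] at this
    exact this h

theorem glue_surj (n : ℕ) (lam : ℕ → ℕ) (hdec : ∀ i j : ℕ, i ≤ j → lam j ≤ lam i)
    (T : Finset ((ℕ × ℕ) × ℕ)) (hT : T ∈ SVT (n + 1) lam) :
    ∃ mu : ℕ → ℕ, (∀ i < n, lam (i + 1) ≤ mu i ∧ mu i ≤ lam i) ∧ (∀ i, n ≤ i → mu i = 0) ∧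
      ∃ S : Finset ℕ, (∀ i ∈ S, i < n ∧ lam (i + 1) < mu i) ∧
        ∃ U ∈ SVT n mu, glue n lam mu S U = T := by
  classical
  have hrow := SVT_row_ge _ _ hdec _ hT
  rw [mem_SVT] at hT
  obtain ⟨ha, hb, hc, hd⟩ := hT
  have hex : ∀ i, ∃ m, ∀ j, j < m ↔ (∃ e, e ≤ n ∧ ((i, j), e) ∈ T) := by
    intro i
    apply lower_exists (lam i)
    · rintro j ⟨e, he, h⟩
      have h1 := ha _ _ _ h
      obtain ⟨f, hf⟩ := hb i j h1.1 (by omega)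
      have := hc _ _ _ _ hf h
      exact ⟨f, by omega, hf⟩
    · rintro j ⟨e, he, h⟩
      exact (ha _ _ _ h).2.1
  choose mu hmu using hex
  have hmu0 : ∀ i, n ≤ i → mu i = 0 := by
    intro i hi
    by_contra h
    obtain ⟨e, he, h'⟩ := (hmu i 0).1 (by omega)
    have := hrow _ _ _ h'
    omega
  have hInterl : ∀ i < n, lam (i + 1) ≤ mu i ∧ mu i ≤ lam i := by
    intro i hi
    constructor
    · by_contra hlt
      obtain ⟨f, hf⟩ := hb (i + 1) (mu i) (by omega) (by omega)
      have := hdec i (i + 1) (by omega)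
      obtain ⟨e, he⟩ := hb i (mu i) (by omega) (by omega)
      have h1 := hd _ _ _ _ he hf
      have h2 := ha _ _ _ hf
      have := (hmu i (mu i)).2 ⟨e, by omega, he⟩
      omega
    · by_contra hlt
      obtain ⟨e, he, h⟩ := (hmu i (lam i)).1 (by omega)
      have := ha _ _ _ h
      omega
  set S := (Finset.range n).filter (fun i => 0 < mu i ∧ ((i, mu i - 1), n + 1) ∈ T) with hSdef
  have hS : ∀ i ∈ S, i < n ∧ lam (i + 1) < mu i := by
    intro i hi
    rw [hSdef, mem_filter, mem_range] at hi
    obtain ⟨h1, h2, h3⟩ := hi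
    refine ⟨h1, ?_⟩
    by_contra hlt
    obtain ⟨f, hf⟩ := hb (i + 1) (mu i - 1) (by omega) (by omega)
    have := hd _ _ _ _ h3 hf
    have := ha _ _ _ hf
    omega
  refine ⟨mu, hInterl, hmu0, S, hS, T.filter (fun x => x.2 ≤ n), ?_, ?_⟩
  · rw [mem_SVT]
    simp only [mem_filter]
    refine ⟨?_, ?_, ?_, ?_⟩
    · rintro i j e ⟨h, he⟩
      have h1 := hrow _ _ _ h
      have h2 := ha _ _ _ h
      exact ⟨by omega, (hmu i j).2 ⟨e, he, h⟩, h2.2.2.1, he⟩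
    · intro i j hi hj
      obtain ⟨e, he, h⟩ := (hmu i j).1 hj
      exact ⟨e, h, he⟩
    · rintro i j e f ⟨h1, _⟩ ⟨h2, _⟩
      exact hc _ _ _ _ h1 h2
    · rintro i j e f ⟨h1, _⟩ ⟨h2, _⟩
      exact hd _ _ _ _ h1 h2
  · ext ⟨⟨i, j⟩, e⟩
    rw [mem_glue n lam mu S _ (hmu0 n le_rfl) (fun i hi => by have := hS i hi; omega), mem_filter]
    constructor
    · rintro (h | h | h)
      · exact h.1
      · obtain ⟨rfl, h1, h2, h3⟩ := h
        obtain ⟨e, he⟩ := hb i j h1 h3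
        have h4 := ha _ _ _ he
        have h5 : ¬ e ≤ n := fun h => by
          have := (hmu i j).2 ⟨e, h, he⟩
          omega
        have : e = n + 1 := by omega
        rwa [this] at he
      · obtain ⟨rfl, h1, h2⟩ := h
        rw [hSdef, mem_filter] at h1
        have : mu i - 1 = j := by omega
        rw [this] at h1
        exact h1.2.2
    · intro h
      have h1 := ha _ _ _ h
      by_cases he : e ≤ n
      · exact Or.inl ⟨h, he⟩
      · have he' : e = n + 1 := by omega
        subst he'
        by_cases hj : mu i ≤ j
        · exact Or.inr (Or.inl ⟨rfl, h1.1, hj, h1.2.1⟩)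
        · refine Or.inr (Or.inr ⟨rfl, ?_, ?_⟩)
          · have hj' : j + 1 = mu i := by
              by_contra hne
              obtain ⟨f, hf, h2⟩ := (hmu i (j + 1)).1 (by omega)
              have := hc _ _ _ _ h h2
              omega
            rw [hSdef, mem_filter, mem_range]
            have hin : i < n := by
              by_contra hni
              have := hmu0 i (by omega)
              omega
            refine ⟨hin, by omega, ?_⟩
            rw [← hj']
            exact h
          · by_contra hne
            obtain ⟨f, hf, h2⟩ := (hmu i (j + 1)).1 (by omega)
            have := hc _ _ _ _ h h2
            omega

theorem shape_unique (n : ℕ) (mu nu : ℕ → ℕ) (T : Finset ((ℕ × ℕ) × ℕ))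
    (h1 : T ∈ SVT n mu) (h2 : T ∈ SVT n nu) : ∀ i < n, mu i = nu i := by
  rw [mem_SVT] at h1 h2
  intro i hi
  apply le_antisymm
  · by_contra h
    obtain ⟨e, he⟩ := h1.2.1 i (nu i) hi (by omega)
    have := h2.1 _ _ _ he
    omega
  · by_contra h
    obtain ⟨e, he⟩ := h2.2.1 i (mu i) hi (by omega)
    have := h1.1 _ _ _ he
    omega

theorem mem_S_iff (n : ℕ) (lam mu : ℕ → ℕ) (hmu : mu n = 0)
    (S : Finset ℕ) (hS : ∀ i ∈ S, i < n ∧ lam (i + 1) < mu i) (T : Finset ((ℕ × ℕ) × ℕ))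
    (hT : T ∈ SVT n mu) (i : ℕ) :
    i ∈ S ↔ 0 < mu i ∧ ((i, mu i - 1), n + 1) ∈ glue n lam mu S T := by
  rw [mem_glue n lam mu S T hmu (fun i hi => by have := hS i hi; omega)]
  rw [mem_SVT] at hT
  constructor
  · intro h
    have := hS i h
    exact ⟨by omega, Or.inr (Or.inr ⟨rfl, h, by omega⟩)⟩
  · rintro ⟨h0, h | h | h⟩
    · have := hT.1 _ _ _ h
      omega
    · omega
    · exact h.2.1

noncomputable def GSum (n : ℕ) (lam : ℕ → ℕ) : Polynomial ℚ :=
  ∑ T ∈ SVT n lam, (Polynomial.X : Polynomial ℚ) ^ (T.card - ∑ i ∈ Finset.range n, lam i)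

theorem GSum_succ (n : ℕ) (lam : ℕ → ℕ) (hdec : ∀ i j : ℕ, i ≤ j → lam j ≤ lam i) :
    GSum (n + 1) lam =
      ∑ m ∈ Fintype.piFinset (fun j : Fin n => Finset.Icc (lam (j.val + 1)) (lam j.val)),
        (∏ j : Fin n, (if lam (j.val + 1) < m j then 1 + (Polynomial.X : Polynomial ℚ) else 1)) *
          GSum n (extZ n m) := by
  classical
  have hprod : ∀ m : Fin n → ℕ,
      (∏ j : Fin n, (if lam (j.val + 1) < m j then 1 + (Polynomial.X : Polynomial ℚ) else 1)) =
      ∑ S ∈ ((Finset.range n).filter (fun i => lam (i + 1) < extZ n m i)).powerset,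
        (Polynomial.X : Polynomial ℚ) ^ S.card := by
    intro m
    have h1 : (∏ j : Fin n, (if lam (j.val + 1) < m j then 1 + (Polynomial.X : Polynomial ℚ) else 1))
        = ∏ i ∈ Finset.range n,
          (if lam (i + 1) < extZ n m i then 1 + (Polynomial.X : Polynomial ℚ) else 1) := by
      rw [Finset.prod_range]
      simp only [extZ_lt]
    rw [h1, ← Finset.prod_filter, Finset.prod_one_add]
    simp
  have hR : (∑ m ∈ Fintype.piFinset (fun j : Fin n => Finset.Icc (lam (j.val + 1)) (lam j.val)),
        (∏ j : Fin n, (if lam (j.val + 1) < m j then 1 + (Polynomial.X : Polynomial ℚ) else 1)) *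
          GSum n (extZ n m)) =
      ∑ q ∈ (Fintype.piFinset (fun j : Fin n => Finset.Icc (lam (j.val + 1)) (lam j.val))).sigma
        (fun m => ((Finset.range n).filter (fun i => lam (i + 1) < extZ n m i)).powerset ×ˢ
          SVT n (extZ n m)),
        (Polynomial.X : Polynomial ℚ) ^
          ((q.2.2.card - ∑ i ∈ Finset.range n, extZ n q.1 i) + q.2.1.card) := by
    rw [Finset.sum_sigma]
    refine Finset.sum_congr rfl fun m _ => ?_
    rw [hprod, Finset.sum_product, GSum, Finset.sum_mul_sum]
    refine Finset.sum_congr rfl fun S _ => Finset.sum_congr rfl fun T _ => ?_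
    rw [pow_add, mul_comm]
  rw [hR, GSum]
  symm
  have hq : ∀ q : (_ : Fin n → ℕ) × (Finset ℕ × Finset ((ℕ × ℕ) × ℕ)),
      q ∈ (Fintype.piFinset (fun j : Fin n => Finset.Icc (lam (j.val + 1)) (lam j.val))).sigma
        (fun m => ((Finset.range n).filter (fun i => lam (i + 1) < extZ n m i)).powerset ×ˢ
          SVT n (extZ n m)) ↔
      (∀ i < n, lam (i + 1) ≤ extZ n q.1 i ∧ extZ n q.1 i ≤ lam i) ∧
      (∀ i ∈ q.2.1, i < n ∧ lam (i + 1) < extZ n q.1 i) ∧ q.2.2 ∈ SVT n (extZ n q.1) := by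
    intro q
    rw [mem_sigma, mem_product, mem_powerset, Fintype.mem_piFinset]
    refine and_congr ?_ (and_congr ?_ Iff.rfl)
    · constructor
      · intro h i hi
        have := h ⟨i, hi⟩
        rw [mem_Icc, ← extZ_lt n q.1] at this
        exact this
      · intro h i
        rw [mem_Icc, ← extZ_lt n q.1]
        exact h i.1 i.2
    · constructor
      · intro h i hi
        have := h hi
        rwa [mem_filter, mem_range] at this
      · intro h i hi
        rw [mem_filter, mem_range]
        exact h i hi
  refine Finset.sum_nbij (fun q => glue n lam (extZ n q.1) q.2.1 q.2.2) ?_ ?_ ?_ ?_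
  · intro q h
    rw [hq] at h
    exact glue_mem n lam _ hdec h.1 (extZ_ge _ _ _ le_rfl) _ h.2.1 _ h.2.2
  · rintro ⟨m, S, T⟩ h ⟨m', S', T'⟩ h' heq
    rw [Finset.mem_coe, hq] at h h'
    simp only at h h' heq
    have e0 := extZ_ge n m n le_rfl
    have e0' := extZ_ge n m' n le_rfl
    have hTT : T = T' := by
      rw [← glue_filter n lam _ e0 S h.2.1 T h.2.2,
        ← glue_filter n lam _ e0' S' h'.2.1 T' h'.2.2, heq]
    subst hTT
    have hmm : m = m' := by
      funext i
      have := shape_unique n _ _ T h.2.2 h'.2.2 i.1 i.2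
      rwa [extZ_lt, extZ_lt] at this
    subst hmm
    have hSS : S = S' := by
      ext i
      rw [mem_S_iff n lam _ e0 S h.2.1 T h.2.2, mem_S_iff n lam _ e0 S' h'.2.1 T h'.2.2, heq]
    subst hSS
    rfl
  · intro T hT
    obtain ⟨mu, h1, h2, S, h3, U, h4, h5⟩ := glue_surj n lam hdec T hT
    have hext : extZ n (fun j : Fin n => mu j.val) = mu := by
      funext i
      by_cases hi : i < n
      · simp [extZ, hi]
      · rw [extZ_ge _ _ _ (by omega), h2 i (by omega)]
    refine ⟨⟨fun j : Fin n => mu j.val, S, U⟩, ?_, ?_⟩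
    · rw [Finset.mem_coe, hq]
      simp only [hext]
      exact ⟨h1, h3, h4⟩
    · simp only [hext]
      exact h5
  · intro q h
    rw [hq] at h
    rw [glue_card n lam _ h.1 _ h.2.1 _ h.2.2]

theorem prod_pairs {R : Type*} [CommMonoid R] (n : ℕ) (f : Fin n × Fin n → R) :
    ∏ p ∈ Finset.univ.filter (fun p : Fin n × Fin n => p.1 < p.2), f p =
      ∏ i : Fin n, ∏ j ∈ Finset.Ioi i, f (i, j) := by
  apply Finset.prod_finset_product
  intro p
  simp

theorem det_choose (n : ℕ) (v : Fin n → ℕ) :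
    (Matrix.of fun j i : Fin n => (-1 : ℚ) ^ i.val * ((v j).choose i.val : ℚ)).det =
      ∏ p ∈ Finset.univ.filter (fun p : Fin n × Fin n => p.1 < p.2),
        (((v p.1 : ℚ) - (v p.2 : ℚ)) / ((p.2.val : ℚ) - (p.1.val : ℚ))) := by
  have h1 := Matrix.det_eval_matrixOfPolynomials_eq_det_vandermonde
    (fun i : Fin n => -(v i : ℚ)) (fun i => ascPochhammer ℚ i.val)
    (fun i => ascPochhammer_natDegree _ _) (fun i => monic_ascPochhammer ℚ _)
  have h2 : (Matrix.of fun j i : Fin n => (ascPochhammer ℚ i.val).eval (-(v j : ℚ))) =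
      Matrix.of fun j i : Fin n => ((i.val.factorial : ℕ) : ℚ) *
        (Matrix.of fun j i : Fin n => (-1 : ℚ) ^ i.val * ((v j).choose i.val : ℚ)) j i := by
    ext j i
    simp only [Matrix.of_apply]
    rw [ascPochhammer_eval_neg_eq_descPochhammer, descPochhammer_eval_eq_descFactorial,
      Nat.descFactorial_eq_factorial_mul_choose]
    push_cast
    ring
  rw [h2, Matrix.det_mul_row, Matrix.det_vandermonde] at h1
  have h3 : (∏ i : Fin n, ((i.val.factorial : ℕ) : ℚ)) =
      ∏ i : Fin n, ∏ j ∈ Finset.Ioi i, ((j.val : ℚ) - (i.val : ℚ)) := by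
    cases n with
    | zero => simp
    | succ n =>
      have := Matrix.det_vandermonde_id_eq_superFactorial (R := ℚ) n
      rw [Matrix.det_vandermonde] at this
      rw [this, ← Nat.prod_range_succ_factorial, Finset.prod_range]
      push_cast
      rfl
  have h4 : (∏ i : Fin n, ((i.val.factorial : ℕ) : ℚ)) ≠ 0 :=
    Finset.prod_ne_zero_iff.2 fun i _ => by positivity
  rw [prod_pairs]
  simp only [Finset.prod_div_distrib]
  rw [← h3, eq_div_iff h4, mul_comm, ← h1]
  refine Finset.prod_congr rfl fun i _ => Finset.prod_congr rfl fun j _ => ?_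
  ring

open Polynomial in
noncomputable def qq (i x : ℕ) : ℚ[X] := (-1) ^ i * (x.choose i : ℚ[X])

open Polynomial in
noncomputable def gg (j i x : ℕ) : ℚ[X] :=
  ∑ k ∈ Finset.range (j + 1), (j.choose k : ℚ[X]) * (X ^ k * qq i (x + k))

open Polynomial in
theorem gg_succ (j i x : ℕ) : gg (j + 1) i x = gg j i x + X * gg j i (x + 1) := by
  unfold gg
  rw [Finset.sum_choose_succ_mul (fun k _ => (X : ℚ[X]) ^ k * qq i (x + k)) j, Finset.mul_sum]
  congr 1
  refine Finset.sum_congr rfl fun k _ => ?_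
  rw [show x + 1 + k = x + (k + 1) by ring]
  ring

theorem gg_diff (j i x : ℕ) : gg j (i + 1) x - gg j (i + 1) (x + 1) = gg j i x := by
  unfold gg
  rw [← Finset.sum_sub_distrib]
  refine Finset.sum_congr rfl fun k _ => ?_
  have : qq (i + 1) (x + k) - qq (i + 1) (x + 1 + k) = qq i (x + k) := by
    unfold qq
    rw [show x + 1 + k = (x + k) + 1 by ring, Nat.choose_succ_succ]
    push_cast
    ring
  rw [← this]
  ring

open Polynomial in
theorem gg_zero (j x : ℕ) : gg j 0 x = (1 + X) ^ j := by
  unfold gg qq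
  rw [add_comm (1 : ℚ[X]), add_pow]
  refine Finset.sum_congr rfl fun k _ => ?_
  simp [mul_comm]

open Polynomial in
theorem gg_sum (j i c a b : ℕ) (hab : a ≤ b) :
    ∑ m ∈ Finset.Icc a b, (if a < m then 1 + (X : ℚ[X]) else 1) * gg j i (m + c) =
      gg (j + 1) (i + 1) (a + c) - (1 + X) * gg j (i + 1) (b + c + 1) := by
  induction b, hab using Nat.le_induction with
  | base =>
    rw [Finset.Icc_self, Finset.sum_singleton, gg_succ, ← gg_diff]
    simp only [lt_irrefl, if_false]
    ring
  | succ b hab ih =>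
    rw [← Finset.insert_Icc_right_eq_Icc_add_one (by omega), Finset.sum_insert (by simp), ih,
      if_pos (by omega), ← gg_diff]
    rw [show b + 1 + c = b + c + 1 by ring]
    ring

open Polynomial in
noncomputable def FDet (n : ℕ) (lam : ℕ → ℕ) : ℚ[X] :=
  (Matrix.of fun j i : Fin n => gg j.val i.val (lam j.val + (n - j.val))).det

open Polynomial in
theorem FDet_succ (n : ℕ) (lam : ℕ → ℕ) (hdec : ∀ i j : ℕ, i ≤ j → lam j ≤ lam i) :
    FDet (n + 1) lam =
      ∑ m ∈ Fintype.piFinset (fun j : Fin n => Finset.Icc (lam (j.val + 1)) (lam j.val)),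
        (∏ j : Fin n, (if lam (j.val + 1) < m j then 1 + (X : ℚ[X]) else 1)) *
          FDet n (extZ n m) := by
  have hR : ∀ m : Fin n → ℕ,
      (∏ j : Fin n, (if lam (j.val + 1) < m j then 1 + (X : ℚ[X]) else 1)) *
          FDet n (extZ n m) =
      Matrix.detRowAlternating (R := ℚ[X]) (n := Fin n) (fun j => (fun (j : Fin n) (a : ℕ) => fun i : Fin n =>
        (if lam (j.val + 1) < a then 1 + (X : ℚ[X]) else 1) *
          gg j.val i.val (a + (n - j.val))) j (m j)) := by
    intro m
    unfold FDet
    rw [← Matrix.det_mul_column]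
    simp only [extZ_lt]
    rfl
  rw [Finset.sum_congr rfl fun m _ => hR m]
  have hms := (Matrix.detRowAlternating (R := ℚ[X]) (n := Fin n)).toMultilinearMap.map_sum_finset
    (fun (j : Fin n) (a : ℕ) => fun i : Fin n =>
        (if lam (j.val + 1) < a then 1 + (X : ℚ[X]) else 1) *
          gg j.val i.val (a + (n - j.val)))
    (fun j : Fin n => Finset.Icc (lam (j.val + 1)) (lam j.val))
  refine Eq.trans ?_ hms
  let B : Matrix (Fin (n + 1)) (Fin (n + 1)) ℚ[X] := Matrix.of fun j i =>
    Fin.cases (gg 0 i.val (lam 0 + (n + 1)))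
      (fun j' : Fin n => gg (j'.val + 1) i.val (lam (j'.val + 1) + (n - j'.val)) -
        (1 + X) * gg j'.val i.val (lam j'.val + (n - j'.val) + 1)) j
  have hAB : FDet (n + 1) lam = B.det := by
    unfold FDet
    refine Matrix.det_eq_of_forall_row_eq_smul_add_pred (fun _ => 1 + X) ?_ ?_
    · intro i
      simp [B]
    · intro j i
      simp only [B, Matrix.of_apply, Fin.cases_succ, Fin.val_succ, Fin.val_castSucc]
      rw [show n + 1 - (j.val + 1) = n - j.val by omega,
        show lam j.val + (n + 1 - j.val) = lam j.val + (n - j.val) + 1 by omega]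
      ring
  rw [hAB, Matrix.det_succ_column_zero, Fin.sum_univ_succ, Finset.sum_eq_zero]
  · have h0 : B 0 0 = 1 := by
      simp [B, gg_zero]
    rw [h0]
    simp only [Fin.val_zero, pow_zero, one_mul, mul_one, add_zero]
    change Matrix.det _ = Matrix.det _
    congr 1
    ext1 j i
    simp only [Matrix.submatrix_apply, Fin.succAbove_zero, B, Matrix.of_apply, Fin.cases_succ,
      Fin.val_succ, Finset.sum_apply]
    exact (gg_sum j.val i.val (n - j.val) _ _ (hdec _ _ (by omega))).symm
  · intro j _
    have h0 : B j.succ 0 = 0 := by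
      simp only [B, Matrix.of_apply, Fin.cases_succ, Fin.val_zero, gg_zero]
      ring
    rw [h0]
    ring

open Polynomial in
theorem FDet_eq (n : ℕ) (lam : ℕ → ℕ) :
    FDet n lam = ∑ k ∈ Fintype.piFinset (fun j : Fin n => Finset.range (j.val + 1)),
          Polynomial.C
            ((∏ j : Fin n, (((j.val).choose (k j) : ℚ))) *
              ∏ p ∈ Finset.univ.filter (fun p : Fin n × Fin n => p.1 < p.2),
                (((lam p.1.val : ℚ) - (lam p.2.val : ℚ) + (k p.1 : ℚ) - (k p.2 : ℚ)
                    + (p.2.val : ℚ) - (p.1.val : ℚ))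
                  / ((p.2.val : ℚ) - (p.1.val : ℚ)))) *
            Polynomial.X ^ (∑ j : Fin n, k j) := by
  have hms := (Matrix.detRowAlternating (R := ℚ[X]) (n := Fin n)).toMultilinearMap.map_sum_finset
    (fun (j : Fin n) (k : ℕ) => fun i : Fin n =>
        ((j.val.choose k : ℚ[X]) * X ^ k) * qq i.val (lam j.val + (n - j.val) + k))
    (fun j : Fin n => Finset.range (j.val + 1))
  have hL : FDet n lam = (Matrix.detRowAlternating (R := ℚ[X]) (n := Fin n)).toMultilinearMap
      (fun j => ∑ k ∈ Finset.range (j.val + 1), fun i : Fin n =>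
        ((j.val.choose k : ℚ[X]) * X ^ k) * qq i.val (lam j.val + (n - j.val) + k)) := by
    unfold FDet
    change Matrix.det _ = Matrix.det _
    congr 1
    ext1 j i
    simp only [Matrix.of_apply, Finset.sum_apply, gg, mul_assoc]
  rw [hL]
  refine hms.trans (Finset.sum_congr rfl fun k _ => ?_)
  have h1 := Matrix.det_mul_column (fun j : Fin n => ((j.val.choose (k j) : ℚ[X]) * X ^ (k j)))
    (Matrix.of fun j i : Fin n => qq i.val (lam j.val + (n - j.val) + k j))
  refine Eq.trans h1 ?_
  have h2 : (Matrix.of fun j i : Fin n => qq i.val (lam j.val + (n - j.val) + k j)) =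
      (Polynomial.C : ℚ →+* ℚ[X]).mapMatrix (Matrix.of fun j i : Fin n =>
        (-1 : ℚ) ^ i.val * ((lam j.val + (n - j.val) + k j).choose i.val : ℚ)) := by
    ext1 j i
    simp [qq]
  rw [h2, ← RingHom.map_det, det_choose, Finset.prod_mul_distrib, Finset.prod_pow_eq_pow_sum,
    Polynomial.C_mul, map_prod (Polynomial.C : ℚ →+* ℚ[X]) (fun j : Fin n => ((j.val.choose (k j) : ℕ) : ℚ))]
  have h3 : ∀ p : Fin n × Fin n,
      ((((lam p.1.val + (n - p.1.val) + k p.1 : ℕ)) : ℚ) -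
        ((lam p.2.val + (n - p.2.val) + k p.2 : ℕ) : ℚ)) =
      ((lam p.1.val : ℚ) - (lam p.2.val : ℚ) + (k p.1 : ℚ) - (k p.2 : ℚ)
                    + (p.2.val : ℚ) - (p.1.val : ℚ)) := by
    intro p
    push_cast [Nat.cast_sub p.1.2.le, Nat.cast_sub p.2.2.le]
    ring
  simp only [h3, map_natCast]
  ring

theorem extZ_dec (n : ℕ) (lam : ℕ → ℕ) (m : Fin n → ℕ)
    (hm : m ∈ Fintype.piFinset (fun j : Fin n => Finset.Icc (lam (j.val + 1)) (lam j.val))) :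
    ∀ i j : ℕ, i ≤ j → extZ n m j ≤ extZ n m i := by
  have : Antitone (extZ n m) := by
    apply antitone_nat_of_succ_le
    intro i
    rw [Fintype.mem_piFinset] at hm
    by_cases h : i + 1 < n
    · have h1 := hm ⟨i, by omega⟩
      have h2 := hm ⟨i + 1, h⟩
      rw [mem_Icc] at h1 h2
      simp only [extZ, h, show i < n by omega, dif_pos]
      exact h2.2.trans h1.1
    · rw [extZ_ge _ _ _ (by omega)]
      omega
  exact fun i j h => this h

theorem GSum_eq_FDet (n : ℕ) : ∀ lam : ℕ → ℕ, (∀ i j : ℕ, i ≤ j → lam j ≤ lam i) →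
    GSum n lam = FDet n lam := by
  induction n with
  | zero =>
    intro lam _
    have h : SVT 0 lam = {∅} := by
      ext T
      rw [mem_SVT, mem_singleton]
      constructor
      · intro h
        rw [Finset.eq_empty_iff_forall_notMem]
        rintro ⟨⟨i, j⟩, e⟩ hx
        have := h.1 _ _ _ hx
        omega
      · rintro rfl
        simp
    simp [GSum, FDet, h]
  | succ n ih =>
    intro lam hdec
    rw [GSum_succ n lam hdec, FDet_succ n lam hdec]
    refine Finset.sum_congr rfl fun m hm => ?_
    rw [ih _ (extZ_dec n lam m hm)]

/-- For `n ≥ 1` and a partition `λ_1 ≥ … ≥ λ_n ≥ 0` padded with zeros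
to length `n` (here `lam : ℕ → ℕ` weakly decreasing with `lam i = 0` for `i ≥ n`), the
principal specialization of the stable Grothendieck polynomial satisfies, as an identity
of polynomials in `β` over `ℚ` (indices `0`-indexed):
`Σ_{T ∈ SVT(λ,n)} β^(|T|−|λ|) = Σ_{k_1=0}^{0} … Σ_{k_n=0}^{n-1} C(0,k_1) ⋯ C(n-1,k_n) ·
β^{k_1+⋯+k_n} · ∏_{1≤i<j≤n} (λ_i − λ_j + k_i − k_j + j − i)/(j − i)`,
i.e. `G_λ(1,…,1 | β) = |SST(λ,n)| · F^(n)(…| −β)` for Holman's `F^(n)`. -/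
theorem grothendieck_principal_eq_holman (n : ℕ) (hn : 1 ≤ n) (lam : ℕ → ℕ)
    (hdec : ∀ i j : ℕ, i ≤ j → lam j ≤ lam i) (hpad : ∀ i : ℕ, n ≤ i → lam i = 0) :
    ∑ T ∈ SVT n lam, (Polynomial.X : Polynomial ℚ) ^ (T.card - ∑ i ∈ Finset.range n, lam i)
      = ∑ k ∈ Fintype.piFinset (fun j : Fin n => Finset.range (j.val + 1)),
          Polynomial.C
            ((∏ j : Fin n, (((j.val).choose (k j) : ℚ))) *
              ∏ p ∈ Finset.univ.filter (fun p : Fin n × Fin n => p.1 < p.2),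
                (((lam p.1.val : ℚ) - (lam p.2.val : ℚ) + (k p.1 : ℚ) - (k p.2 : ℚ)
                    + (p.2.val : ℚ) - (p.1.val : ℚ))
                  / ((p.2.val : ℚ) - (p.1.val : ℚ)))) *
            Polynomial.X ^ (∑ j : Fin n, k j) := by
  exact (GSum_eq_FDet n lam hdec).trans (FDet_eq n lam)
end
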